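/- (Convergence of tabular ξ-learning.) Let S, A, Φ be finite nonempty sets, γ ∈ [0,1), R : Φ → ℝ, P(s'|s,a) a stochastic transition matrix on S × A, and p(φ|s,a) a probability distribution over Φ for each (s,a). On a probability space, let (s_k, a_k, s_{k+1})_{k≥0} be a random sequence of transitions adapted to a filtration such that, conditionally on the past, s_{k+1} is distributed according to P(·|s_k,a_k). Define ξ-iterates ξ_k : S × A × Φ → ℝ from an arbitrary ξ₀ by: ξ_{k+1}(s,a,φ) = ξ_k(s,a,φ) for (s,a) ≠ (s_k,a_k), and ξ_{k+1}(s_k,a_k,φ) = (1 − α_k) ξ_k(s_k,a_k,φ) + α_k ( p(φ|s_k,a_k) + γ ξ_k(s_{k+1}, ā_{k+1}, φ) ), where ā_{k+1} ∈ argmax_a Σ_{φ'∈Φ} R(φ') ξ_k(s_{k+1}, a, φ') and α_k ∈ (0,1] is the learning rate used at step k. If almost surely every pair (s,a) ∈ S × A is visited infinitely often, and for every (s,a) the learning rates used at the visits to (s,a) satisfy the Robbins–Monro conditions Σ α = ∞ and Σ α² < ∞ almost surely, then almost surely the induced Q-iterates Q_k(s,a) = Σ_{φ∈Φ} R(φ)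 ξ_k(s,a,φ) converge, for every (s,a), to Q*(s,a), the unique fixed point of the Bellman optimality operator (T Q)(s,a) = Σ_φ p(φ|s,a) R(φ) + γ Σ_{s'} P(s'|s,a) max_{a'} Q(s',a'); that is, the classes [ξ_k] converge to the optimal class [ξ*]. -/

import Mathlib

open MeasureTheory ProbabilityTheory Filter Classical

/-- A recursive average whose inputs are eventually bounded by `C` is eventually bounded by
`C + ε`, as soon as the weights are not summable. -/
theorem eventually_abs_le_of_average {x β c : ℕ → ℝ} {C ε : ℝ}
    (hβ0 : ∀ k, 0 ≤ β k) (hβ1 : ∀ k, β k ≤ 1) (hβ : ¬ Summable β)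
    (hx : ∀ k, x (k + 1) = (1 - β k) * x k + β k * c k)
    (hc : ∀ᶠ k in atTop, |c k| ≤ C) (hε : 0 < ε) :
    ∀ᶠ k in atTop, |x k| ≤ C + ε := by
  obtain ⟨N, hN⟩ := eventually_atTop.1 hc
  have hC : 0 ≤ C := (abs_nonneg _).trans (hN N le_rfl)
  have hbound : ∀ n, |x (n + N)| ≤
      C + |x N| * Real.exp (-∑ j ∈ Finset.range n, β (j + N)) := by
    intro n
    induction n with
    | zero => simpa using hC
    | succ n ih =>
      set E := Real.exp (-∑ j ∈ Finset.range n, β (j + N)) with hE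
      have h1 : 0 ≤ 1 - β (n + N) := sub_nonneg.2 (hβ1 _)
      have h2 : 1 - β (n + N) ≤ Real.exp (-β (n + N)) := by
        have := Real.add_one_le_exp (-β (n + N)); linarith
      have h3 : |x (n + 1 + N)| ≤ (1 - β (n + N)) * |x (n + N)| + β (n + N) * C := by
        rw [show n + 1 + N = n + N + 1 by ring, hx]
        refine (abs_add_le _ _).trans ?_
        rw [abs_mul, abs_mul, abs_of_nonneg h1, abs_of_nonneg (hβ0 _)]
        have := mul_le_mul_of_nonneg_left (hN (n + N) (by omega)) (hβ0 (n + N))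
        linarith
      have h4 := mul_le_mul_of_nonneg_left ih h1
      have h5 : (1 - β (n + N)) * (|x N| * E) ≤ Real.exp (-β (n + N)) * (|x N| * E) :=
        mul_le_mul_of_nonneg_right h2 (by positivity)
      rw [Finset.sum_range_succ, neg_add, Real.exp_add, ← hE]
      linarith
  have hsum : Tendsto (fun n => ∑ j ∈ Finset.range n, β (j + N)) atTop atTop :=
    (not_summable_iff_tendsto_nat_atTop_of_nonneg fun j => hβ0 _).1
      fun h => hβ ((summable_nat_add_iff N).1 h)
  have hlim : Tendsto (fun n => |x N| * Real.exp (-∑ j ∈ Finset.range n, β (j + N)))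
      atTop (nhds 0) := by
    simpa using (Real.tendsto_exp_neg_atTop_nhds_zero.comp hsum).const_mul |x N|
  obtain ⟨M, hM⟩ := eventually_atTop.1 (hlim.eventually (gt_mem_nhds hε))
  refine eventually_atTop.2 ⟨M + N, fun k hk => ?_⟩
  have h1 := hbound (k - N)
  have h2 := hM (k - N) (by omega)
  rw [show k - N + N = k by omega] at h1
  linarith

/-- A recursive average of a noise whose weighted series converges tends to zero. -/
theorem tendsto_zero_of_average_noise {W β w : ℕ → ℝ} {M : ℝ}
    (hβ0 : ∀ k, 0 ≤ β k) (hβ1 : ∀ k, β k ≤ 1) (hβ : ¬ Summable β)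
    (hW : ∀ k, W (k + 1) = (1 - β k) * W k + β k * w k)
    (hM : Tendsto (fun n => ∑ k ∈ Finset.range n, β k * w k) atTop (nhds M)) :
    Tendsto W atTop (nhds 0) := by
  set t : ℕ → ℝ := fun n => M - ∑ k ∈ Finset.range n, β k * w k with ht
  have htlim : Tendsto t atTop (nhds 0) := by simpa [ht] using hM.const_sub M
  have hrec : ∀ k, W (k + 1) + t (k + 1) = (1 - β k) * (W k + t k) + β k * t k := by
    intro k
    simp only [ht, Finset.sum_range_succ, hW]
    ring
  have hsmall : ∀ ε > 0, ∀ᶠ k in atTop, |t k| ≤ ε := fun ε hε => by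
    filter_upwards [(Metric.tendsto_nhds.1 htlim) ε hε] with k hk
    simpa using hk.le
  rw [Metric.tendsto_nhds]
  intro ε hε
  have hε4 : 0 < ε / 4 := by positivity
  filter_upwards [hsmall _ hε4, eventually_abs_le_of_average (x := fun k => W k + t k)
    hβ0 hβ1 hβ hrec (hsmall _ hε4) hε4] with k h1 h2
  rw [Real.dist_eq, sub_zero]
  have := abs_sub (W k + t k) (t k)
  rw [add_sub_cancel_right] at this
  linarith

/-- Asynchronous stochastic approximation of a `γ`-contraction, pathwise: bounded errors
tend to zero when the weighted noise series converge. -/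
theorem tendsto_zero_of_contraction_noise {I : Type*} [Finite I] {e β F w : ℕ → I → ℝ}
    {γ B : ℝ} (hγ0 : 0 ≤ γ) (hγ1 : γ < 1)
    (hβ0 : ∀ k i, 0 ≤ β k i) (hβ1 : ∀ k i, β k i ≤ 1) (hβ : ∀ i, ¬ Summable fun k => β k i)
    (he : ∀ k i, e (k + 1) i = (1 - β k i) * e k i + β k i * (F k i + w k i))
    (hF : ∀ k D, (∀ i, |e k i| ≤ D) → ∀ i, |F k i| ≤ γ * D)
    (hw : ∀ i, ∃ M, Tendsto (fun n => ∑ k ∈ Finset.range n, β k i * w k i) atTop (nhds M))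
    (hB : ∀ k i, |e k i| ≤ B) (i : I) :
    Tendsto (fun k => e k i) atTop (nhds 0) := by
  let W : ℕ → I → ℝ := fun k i =>
    Nat.rec 0 (fun k W => (1 - β k i) * W + β k i * w k i) k
  have hWrec : ∀ k i, W (k + 1) i = (1 - β k i) * W k i + β k i * w k i := fun _ _ => rfl
  have hW : ∀ i, Tendsto (fun k => W k i) atTop (nhds 0) := fun i =>
    (hw i).elim fun M hM => tendsto_zero_of_average_noise (fun k => hβ0 k i)
      (fun k => hβ1 k i) (hβ i) (fun k => hWrec k i) hM
  have hB0 : 0 ≤ B := (abs_nonneg _).trans (hB 0 i)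
  have step : ∀ D > 0, (∀ᶠ k in atTop, ∀ i, |e k i| ≤ D) →
      ∀ᶠ k in atTop, ∀ i, |e k i| ≤ (1 + γ) / 2 * D := by
    intro D hD hev
    rw [eventually_all]
    intro i
    have hε : 0 < (1 - γ) / 4 * D := by
      have : 0 < 1 - γ := sub_pos.2 hγ1
      positivity
    have hY := eventually_abs_le_of_average (x := fun k => e k i - W k i)
      (c := fun k => F k i) (fun k => hβ0 k i) (fun k => hβ1 k i) (hβ i)
      (fun k => by rw [he, hWrec]; ring) (hev.mono fun k hk => hF k D hk i) hε
    filter_upwards [hY, (Metric.tendsto_nhds.1 (hW i)) _ hε] with k h1 h2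
    rw [Real.dist_eq, sub_zero] at h2
    have := abs_add_le (e k i - W k i) (W k i)
    rw [sub_add_cancel] at this
    linarith
  have hpow : ∀ n : ℕ, ∀ᶠ k in atTop, ∀ i, |e k i| ≤ ((1 + γ) / 2) ^ n * (B + 1) := by
    intro n
    induction n with
    | zero => exact Eventually.of_forall fun k i => by have := hB k i; simp; linarith
    | succ n ih =>
      refine (step _ (by positivity) ih).mono fun k hk i => (hk i).trans_eq ?_
      ring
  have hlim : Tendsto (fun n : ℕ => ((1 + γ) / 2) ^ n * (B + 1)) atTop (nhds 0) := by
    simpa using (tendsto_pow_atTop_nhds_zero_of_lt_one (r := (1 + γ) / 2)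
      (by linarith) (by linarith)).mul_const (B + 1)
  rw [Metric.tendsto_nhds]
  intro ε hε
  obtain ⟨n, hn⟩ := (hlim.eventually (gt_mem_nhds hε)).exists
  filter_upwards [hpow n] with k hk
  rw [Real.dist_eq, sub_zero]
  exact (hk i).trans_lt hn

/-- A martingale transform with square-summable predictable weights converges: version with
a deterministic bound on the sum of the squared weights. -/
theorem ae_exists_tendsto_transform_of_sum_sq_le {Ω : Type*} [m0 : MeasurableSpace Ω]
    {μ : Measure Ω} [IsProbabilityMeasure μ] {ℱ : Filtration ℕ m0} {b w : ℕ → Ω → ℝ} {C K : ℝ}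
    (hb : ∀ k, Measurable[ℱ k] (b k)) (hbC : ∀ k ω, |b k ω| ≤ C)
    (hbK : ∀ n ω, ∑ k ∈ Finset.range n, b k ω ^ 2 ≤ K)
    (hw : ∀ k, Measurable[ℱ (k + 1)] (w k)) (hw1 : ∀ k ω, |w k ω| ≤ 1)
    (hw0 : ∀ k, μ[w k|ℱ k] =ᵐ[μ] 0) :
    ∀ᵐ ω ∂μ, ∃ c, Tendsto (fun n => ∑ k ∈ Finset.range n, b k ω * w k ω) atTop (nhds c) := by
  set M : ℕ → Ω → ℝ := fun n ω => ∑ k ∈ Finset.range n, b k ω * w k ω with hM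
  have hMmeas : ∀ n, Measurable[ℱ n] (M n) := fun n =>
    Finset.measurable_fun_sum _ fun k hk =>
      ((hb k).mono (ℱ.mono (Finset.mem_range.1 hk).le) le_rfl).mul
        ((hw k).mono (ℱ.mono (Finset.mem_range.1 hk)) le_rfl)
  have hbw : ∀ k ω, |b k ω * w k ω| ≤ C := fun k ω => by
    rw [abs_mul]
    exact (mul_le_of_le_one_right (abs_nonneg _) (hw1 k ω)).trans (hbC k ω)
  have hMbd : ∀ n ω, |M n ω| ≤ n * C := fun n ω =>
    (Finset.abs_sum_le_sum_abs _ _).trans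
      ((Finset.sum_le_sum fun k _ => hbw k ω).trans_eq (by simp))
  have integrable_of_bdd : ∀ {f : Ω → ℝ} (D : ℝ), Measurable f → (∀ ω, |f ω| ≤ D) → Integrable f μ :=
    fun D hf hD => Integrable.of_bound hf.aestronglyMeasurable D (Eventually.of_forall hD)
  have hbm : ∀ k, Measurable (b k) := fun k => (hb k).mono (ℱ.le k) le_rfl
  have hwm : ∀ k, Measurable (w k) := fun k => (hw k).mono (ℱ.le _) le_rfl
  have hMm : ∀ k, Measurable (M k) := fun k => (hMmeas k).mono (ℱ.le _) le_rfl
  have hwint : ∀ k, Integrable (w k) μ := fun k => integrable_of_bdd 1 (hwm k) (hw1 k)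
  have hMint : ∀ n, Integrable (M n) μ := fun n => integrable_of_bdd _ (hMm n) (hMbd n)
  have hpull : ∀ k (g : Ω → ℝ) (D : ℝ), Measurable[ℱ k] g → (∀ ω, |g ω| ≤ D) →
      μ[g * w k|ℱ k] =ᵐ[μ] 0 := by
    intro k g D hg hD
    refine (condExp_stronglyMeasurable_mul_of_bound (ℱ.le k) hg.stronglyMeasurable (hwint k) D
      (Eventually.of_forall hD)).trans ?_
    filter_upwards [hw0 k] with ω hω
    simp [hω]
  have hmart : Martingale M ℱ μ := by
    refine martingale_of_condExp_sub_eq_zero_nat (fun n => (hMmeas n).stronglyMeasurable) hMint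
      fun n => ?_
    have : M (n + 1) - M n = b n * w n := by
      ext ω
      simp [hM, Finset.sum_range_succ]
    rw [this]
    exact hpull n _ C (hb n) (hbC n)
  have hsqint : ∀ n, Integrable (fun ω => M n ω ^ 2) μ := fun n =>
    integrable_of_bdd ((n * C) ^ 2) ((hMm n).pow_const 2) fun ω => by
      rw [abs_pow]; exact pow_le_pow_left₀ (abs_nonneg _) (hMbd n ω) 2
  have hbsqint : ∀ n, Integrable (fun ω => b n ω ^ 2) μ := fun n =>
    integrable_of_bdd (C ^ 2) ((hbm n).pow_const 2) fun ω => by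
      rw [abs_pow]; exact pow_le_pow_left₀ (abs_nonneg _) (hbC n ω) 2
  have hsq : ∀ n, ∫ ω, M n ω ^ 2 ∂μ ≤ ∫ ω, ∑ k ∈ Finset.range n, b k ω ^ 2 ∂μ := by
    intro n
    induction n with
    | zero => simp [hM]
    | succ n ih =>
      have hMb : ∀ ω, |M n ω * b n ω| ≤ n * C * C := fun ω => by
        rw [abs_mul]
        exact mul_le_mul (hMbd n ω) (hbC n ω) (abs_nonneg _) ((abs_nonneg _).trans (hMbd n ω))
      have hcross : ∫ ω, M n ω * b n ω * w n ω ∂μ = 0 := by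
        have h1 := hpull n (M n * b n) (n * C * C) ((hMmeas n).mul (hb n)) hMb
        have h2 := integral_condExp (μ := μ) (f := M n * b n * w n) (ℱ.le n)
        rw [integral_congr_ae h1] at h2
        simpa using h2.symm
      have hcint : Integrable (fun ω => M n ω * b n ω * w n ω) μ :=
        integrable_of_bdd (n * C * C) (((hMm n).mul (hbm n)).mul (hwm n)) fun ω => by
          rw [abs_mul]
          exact (mul_le_of_le_one_right (abs_nonneg _) (hw1 n ω)).trans (hMb ω)
      have hsumint : Integrable (fun ω => ∑ k ∈ Finset.range n, b k ω ^ 2) μ :=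
        integrable_finsetSum _ fun k _ => hbsqint k
      calc ∫ ω, M (n + 1) ω ^ 2 ∂μ
          ≤ ∫ ω, (M n ω ^ 2 + 2 * (M n ω * b n ω * w n ω) + b n ω ^ 2) ∂μ := by
            refine integral_mono (hsqint _)
              (((hsqint n).add (hcint.const_mul 2)).add (hbsqint n)) fun ω => ?_
            have h1 : w n ω ^ 2 ≤ 1 := (sq_le_one_iff_abs_le_one _).2 (hw1 n ω)
            have h2 : M (n + 1) ω = M n ω + b n ω * w n ω := by
              simp [hM, Finset.sum_range_succ]
            have h3 := mul_le_mul_of_nonneg_left h1 (sq_nonneg (b n ω))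
            simp only [h2]
            linarith
        _ = ∫ ω, M n ω ^ 2 ∂μ + ∫ ω, b n ω ^ 2 ∂μ := by
            have hadd : Integrable (fun ω => M n ω ^ 2 + 2 * (M n ω * b n ω * w n ω)) μ :=
              (hsqint n).add (hcint.const_mul 2)
            rw [integral_add hadd (hbsqint n),
              integral_add (hsqint n) (hcint.const_mul 2), integral_const_mul, hcross]
            ring
        _ ≤ ∫ ω, ∑ k ∈ Finset.range (n + 1), b k ω ^ 2 ∂μ := by
            simp only [Finset.sum_range_succ]
            rw [integral_add hsumint (hbsqint n)]
            linarith
  refine hmart.submartingale.exists_ae_tendsto_of_bdd (R := (1 + K).toNNReal) fun n => ?_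
  rw [eLpNorm_one_eq_lintegral_enorm, ← ofReal_integral_norm_eq_lintegral_enorm (hMint n)]
  refine ENNReal.ofReal_le_ofReal ?_
  have h1 : ∫ ω, ∑ k ∈ Finset.range n, b k ω ^ 2 ∂μ ≤ K := by
    refine (integral_mono (integrable_finsetSum _ fun k _ => hbsqint k)
      (integrable_const K) fun ω => hbK n ω).trans_eq (by simp)
  have h2 : ∫ ω, ‖M n ω‖ ∂μ ≤ ∫ ω, (1 + M n ω ^ 2) ∂μ := by
    refine integral_mono (hMint n).norm ((integrable_const 1).add (hsqint n)) fun ω => ?_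
    have := sq_nonneg (|M n ω| - 1)
    simp only [Real.norm_eq_abs]
    nlinarith [sq_abs (M n ω), abs_nonneg (M n ω)]
  rw [integral_add (integrable_const 1) (hsqint n)] at h2
  have := hsq n
  simp only [integral_const, probReal_univ, one_smul] at h2
  linarith

/-- A martingale transform with almost surely square-summable, bounded predictable weights
converges almost surely. -/
theorem ae_exists_tendsto_transform {Ω : Type*} [m0 : MeasurableSpace Ω]
    {μ : Measure Ω} [IsProbabilityMeasure μ] {ℱ : Filtration ℕ m0} {b w : ℕ → Ω → ℝ} {C : ℝ}
    (hb : ∀ k, Measurable[ℱ k] (b k)) (hbC : ∀ k ω, |b k ω| ≤ C)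
    (hbs : ∀ᵐ ω ∂μ, Summable fun k => b k ω ^ 2)
    (hw : ∀ k, Measurable[ℱ (k + 1)] (w k)) (hw1 : ∀ k ω, |w k ω| ≤ 1)
    (hw0 : ∀ k, μ[w k|ℱ k] =ᵐ[μ] 0) :
    ∀ᵐ ω ∂μ, ∃ c, Tendsto (fun n => ∑ k ∈ Finset.range n, b k ω * w k ω) atTop (nhds c) := by
  let V : ℕ → Ω → ℝ := fun k ω => ∑ j ∈ Finset.range (k + 1), b j ω ^ 2
  let t : ℕ → ℕ → Ω → ℝ := fun N k ω => if V k ω ≤ N then b k ω else 0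
  have hV : ∀ k, Measurable[ℱ k] (V k) := fun k =>
    Finset.measurable_fun_sum _ fun j hj =>
      ((hb j).mono (ℱ.mono (Nat.lt_succ_iff.1 (Finset.mem_range.1 hj))) le_rfl).pow_const 2
  have ht : ∀ N k, Measurable[ℱ k] (t N k) := fun N k =>
    Measurable.ite (measurableSet_le (hV k) measurable_const) (hb k) measurable_const
  have htb : ∀ N k ω, |t N k ω| ≤ |b k ω| := fun N k ω => by
    simp only [t]
    split_ifs <;> simp
  have htsq : ∀ N n ω, ∑ k ∈ Finset.range n, t N k ω ^ 2 ≤ N := by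
    intro N n ω
    induction n with
    | zero => simp
    | succ n ih =>
      by_cases h : V n ω ≤ N
      · exact (Finset.sum_le_sum fun k _ => sq_le_sq.2 (htb N k ω)).trans h
      · rw [Finset.sum_range_succ]
        simpa [t, h] using ih
  have hconv : ∀ᵐ ω ∂μ, ∀ N : ℕ, ∃ c,
      Tendsto (fun n => ∑ k ∈ Finset.range n, t N k ω * w k ω) atTop (nhds c) :=
    ae_all_iff.2 fun N => ae_exists_tendsto_transform_of_sum_sq_le (ht N)
      (fun k ω => (htb N k ω).trans (hbC k ω)) (htsq N) hw hw1 hw0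
  filter_upwards [hconv, hbs] with ω h1 h2
  obtain ⟨N, hN⟩ := exists_nat_ge (∑' k, b k ω ^ 2)
  have hteq : ∀ k, t N k ω = b k ω := fun k =>
    if_pos ((h2.sum_le_tsum _ fun _ _ => sq_nonneg _).trans hN)
  simpa only [hteq] using h1 N

theorem abs_ciSup_sub_ciSup_le {A : Type*} [Finite A] [Nonempty A] {f g : A → ℝ} {D : ℝ}
    (h : ∀ a, |f a - g a| ≤ D) : |(⨆ a, f a) - ⨆ a, g a| ≤ D := by
  have hf : BddAbove (Set.range f) := (Set.finite_range f).bddAbove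
  have hg : BddAbove (Set.range g) := (Set.finite_range g).bddAbove
  have h1 : (⨆ a, f a) ≤ (⨆ a, g a) + D := ciSup_le fun a => by
    have := le_ciSup hg a
    have := (abs_le.1 (h a)).2
    linarith
  have h2 : (⨆ a, g a) ≤ (⨆ a, f a) + D := ciSup_le fun a => by
    have := le_ciSup hf a
    have := (abs_le.1 (h a)).1
    linarith
  exact abs_le.2 ⟨by linarith, by linarith⟩

theorem abs_ciSup_le {A : Type*} [Finite A] [Nonempty A] {f : A → ℝ} {D : ℝ}
    (h : ∀ a, |f a| ≤ D) : |⨆ a, f a| ≤ D := by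
  simpa using abs_ciSup_sub_ciSup_le (g := fun _ => 0) (by simpa using h)

theorem abs_sum_mul_le_of_stochastic {S : Type*} [Fintype S] {P f : S → ℝ} {D : ℝ}
    (hP0 : ∀ s, 0 ≤ P s) (hP1 : ∑ s, P s = 1) (h : ∀ s, |f s| ≤ D) :
    |∑ s, P s * f s| ≤ D := by
  calc |∑ s, P s * f s| ≤ ∑ s, |P s * f s| := Finset.abs_sum_le_sum_abs _ _
    _ ≤ ∑ s, P s * D := Finset.sum_le_sum fun s _ => by
        rw [abs_mul, abs_of_nonneg (hP0 s)]
        exact mul_le_mul_of_nonneg_left (h s) (hP0 s)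
    _ = D := by rw [← Finset.sum_mul, hP1, one_mul]

/-- Iterates of the Q-learning recursion are bounded by a deterministic constant. -/
theorem exists_abs_qIterate_le {S A Ω : Type*} [Fintype S] [Fintype A] [Nonempty A]
    {γ : ℝ} (hγ0 : 0 ≤ γ) (hγ1 : γ < 1) {r q₀ : S → A → ℝ}
    {st : ℕ → Ω → S} {ac : ℕ → Ω → A} {α : ℕ → Ω → ℝ}
    (hα : ∀ k ω, α k ω ∈ Set.Ioc (0 : ℝ) 1) {q : ℕ → Ω → S → A → ℝ}
    (hq0 : ∀ ω, q 0 ω = q₀)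
    (hq : ∀ k ω s a, q (k + 1) ω s a = if s = st k ω ∧ a = ac k ω then
      (1 - α k ω) * q k ω s a + α k ω * (r s a + γ * ⨆ a', q k ω (st (k + 1) ω) a')
      else q k ω s a) :
    ∃ B, ∀ k ω s a, |q k ω s a| ≤ B := by
  have hle : ∀ (f : S → A → ℝ) s a, |f s a| ≤ ∑ x : S × A, |f x.1 x.2| := fun f s a =>
    Finset.single_le_sum (f := fun x : S × A => |f x.1 x.2|) (fun _ _ => abs_nonneg _)
      (Finset.mem_univ (s, a))
  set K := ∑ x : S × A, |q₀ x.1 x.2|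
  set L := ∑ x : S × A, |r x.1 x.2|
  have hK : 0 ≤ K := Finset.sum_nonneg fun _ _ => abs_nonneg _
  have hL : 0 ≤ L := Finset.sum_nonneg fun _ _ => abs_nonneg _
  have hγ : 0 < 1 - γ := sub_pos.2 hγ1
  have hLB : L / (1 - γ) = L + γ * (L / (1 - γ)) := by field_simp; ring
  have hdiv : 0 ≤ L / (1 - γ) := by positivity
  refine ⟨K + L / (1 - γ), fun k ω => ?_⟩
  induction k with
  | zero => intro s a; rw [hq0]; have := hle q₀ s a; linarith
  | succ k ih =>
    intro s a
    rw [hq]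
    split_ifs
    · obtain ⟨h0, h1⟩ := hα k ω
      have hsup := abs_ciSup_le (ih (st (k + 1) ω))
      have htarget : |r s a + γ * ⨆ a', q k ω (st (k + 1) ω) a'| ≤ K + L / (1 - γ) := by
        refine (abs_add_le _ _).trans ?_
        rw [abs_mul, abs_of_nonneg hγ0]
        have h2 := mul_le_mul_of_nonneg_left hsup hγ0
        have h3 := mul_le_of_le_one_left hK hγ1.le
        have := hle r s a
        linarith
      refine (abs_add_le _ _).trans ?_
      rw [abs_mul, abs_mul, abs_of_pos h0, abs_of_nonneg (sub_nonneg.2 h1)]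
      have h2 := mul_le_mul_of_nonneg_left htarget h0.le
      have h3 := mul_le_mul_of_nonneg_left (ih s a) (sub_nonneg.2 h1)
      linarith
    · exact ih s a

/-- Iterates of the Q-learning recursion are adapted. -/
theorem measurable_qIterate {S A Ω : Type*} [Fintype S] [Fintype A]
    [MeasurableSpace S] [MeasurableSingletonClass S]
    [MeasurableSpace A] [MeasurableSingletonClass A]
    [m0 : MeasurableSpace Ω] {ℱ : Filtration ℕ m0} {γ : ℝ} {r q₀ : S → A → ℝ}
    {st : ℕ → Ω → S} {ac : ℕ → Ω → A} {α : ℕ → Ω → ℝ}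
    (hst : ∀ k, Measurable[ℱ k] (st k)) (hac : ∀ k, Measurable[ℱ k] (ac k))
    (hα : ∀ k, Measurable[ℱ k] (α k)) {q : ℕ → Ω → S → A → ℝ}
    (hq0 : ∀ ω, q 0 ω = q₀)
    (hq : ∀ k ω s a, q (k + 1) ω s a = if s = st k ω ∧ a = ac k ω then
      (1 - α k ω) * q k ω s a + α k ω * (r s a + γ * ⨆ a', q k ω (st (k + 1) ω) a')
      else q k ω s a) (k : ℕ) :
    ∀ s a, Measurable[ℱ k] fun ω => q k ω s a := by
  induction k with
  | zero => intro s a; simp only [hq0]; exact measurable_const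
  | succ k ih =>
    intro s a
    have hle : ℱ k ≤ ℱ (k + 1) := ℱ.mono k.le_succ
    have hqm : ∀ s a, Measurable[ℱ (k + 1)] fun ω => q k ω s a := fun s a =>
      (ih s a).mono hle le_rfl
    have hαm : Measurable[ℱ (k + 1)] (α k) := (hα k).mono hle le_rfl
    have hsup : Measurable[ℱ (k + 1)] fun ω => ⨆ a', q k ω (st (k + 1) ω) a' := by
      have : (fun ω => ⨆ a', q k ω (st (k + 1) ω) a') =
          fun ω => ∑ s', if st (k + 1) ω = s' then ⨆ a', q k ω s' a' else 0 := by
        ext ω; simp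
      rw [this]
      exact Finset.measurable_fun_sum _ fun s' _ =>
        Measurable.ite (hst (k + 1) (measurableSet_singleton s'))
          (Measurable.iSup fun a' => hqm s' a') measurable_const
    have hset : MeasurableSet[ℱ (k + 1)] {ω | s = st k ω ∧ a = ac k ω} := by
      have h1 := hle _ (hst k (measurableSet_singleton s))
      have h2 := hle _ (hac k (measurableSet_singleton a))
      convert h1.inter h2 using 1
      ext ω
      simp [eq_comm]
    simp only [hq]
    exact Measurable.ite hset
      (((measurable_const.sub hαm).mul (hqm s a)).add
        (hαm.mul (measurable_const.add (measurable_const.mul hsup)))) (hqm s a)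

/-- The weighted sampling noise of the next state has an almost surely convergent series,
for weights that are bounded, predictable and almost surely square-summable. -/
theorem ae_exists_tendsto_nextState_noise {S A Ω : Type*} [Fintype S] [Finite A]
    [MeasurableSpace S] [MeasurableSingletonClass S]
    [MeasurableSpace A] [MeasurableSingletonClass A]
    [m0 : MeasurableSpace Ω] {μ : Measure Ω} [IsProbabilityMeasure μ] {ℱ : Filtration ℕ m0}
    {P : S → A → S → ℝ} (hP0 : ∀ s a s', 0 ≤ P s a s') (hP1 : ∀ s a, ∑ s', P s a s' = 1)
    {st : ℕ → Ω → S} {ac : ℕ → Ω → A}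
    (hst : ∀ k, Measurable[ℱ k] (st k)) (hac : ∀ k, Measurable[ℱ k] (ac k))
    (hcond : ∀ k (f : S → ℝ), μ[fun ω => f (st (k + 1) ω)|ℱ k]
      =ᵐ[μ] fun ω => ∑ s', P (st k ω) (ac k ω) s' * f s')
    {b : ℕ → Ω → ℝ} {C : ℝ} (hb : ∀ k, Measurable[ℱ k] (b k)) (hbC : ∀ k ω, |b k ω| ≤ C)
    (hbs : ∀ᵐ ω ∂μ, Summable fun k => b k ω ^ 2) (s' : S) :
    ∀ᵐ ω ∂μ, ∃ c, Tendsto (fun n => ∑ k ∈ Finset.range n,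
      b k ω * ((if st (k + 1) ω = s' then 1 else 0) - P (st k ω) (ac k ω) s'))
      atTop (nhds c) := by
  have hPle : ∀ s a, P s a s' ≤ 1 := fun s a => (hP1 s a) ▸
    Finset.single_le_sum (fun x _ => hP0 s a x) (Finset.mem_univ s')
  have hind : ∀ k, Measurable[ℱ (k + 1)] fun ω => if st (k + 1) ω = s' then (1 : ℝ) else 0 :=
    fun k => Measurable.ite (hst (k + 1) (measurableSet_singleton s'))
      measurable_const measurable_const
  have hPm : ∀ k, Measurable[ℱ k] fun ω => P (st k ω) (ac k ω) s' := fun k =>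
    (measurable_of_countable fun x : S × A => P x.1 x.2 s').comp ((hst k).prodMk (hac k))
  refine ae_exists_tendsto_transform hb hbC hbs
    (fun k => (hind k).sub ((hPm k).mono (ℱ.mono k.le_succ) le_rfl)) (fun k ω => ?_) fun k => ?_
  · have h0 := hP0 (st k ω) (ac k ω) s'
    have h1 := hPle (st k ω) (ac k ω)
    split_ifs <;> exact abs_le.2 ⟨by linarith, by linarith⟩
  · have hint1 : Integrable (fun ω => if st (k + 1) ω = s' then (1 : ℝ) else 0) μ :=
      Integrable.of_bound ((hind k).mono (ℱ.le _) le_rfl).aestronglyMeasurable 1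
        (Eventually.of_forall fun ω => by split_ifs <;> simp)
    have hint2 : Integrable (fun ω => P (st k ω) (ac k ω) s') μ :=
      Integrable.of_bound ((hPm k).mono (ℱ.le _) le_rfl).aestronglyMeasurable 1
        (Eventually.of_forall fun ω => by
          rw [Real.norm_eq_abs, abs_of_nonneg (hP0 _ _ _)]; exact hPle _ _)
    have h1 := hcond k fun x => if x = s' then 1 else 0
    have h2 := condExp_of_stronglyMeasurable (ℱ.le k) (hPm k).stronglyMeasurable hint2
    refine (condExp_sub hint1 hint2 (ℱ k)).trans ?_
    filter_upwards [h1] with ω hω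
    rw [Pi.sub_apply, h2, hω]
    simp

/-- Almost sure convergence of tabular Q-learning with deterministic rewards. -/
theorem ae_tendsto_qIterate {S A Ω : Type*} [Fintype S] [Fintype A] [Nonempty A]
    [MeasurableSpace S] [MeasurableSingletonClass S]
    [MeasurableSpace A] [MeasurableSingletonClass A]
    [m0 : MeasurableSpace Ω] {μ : Measure Ω} [IsProbabilityMeasure μ] {ℱ : Filtration ℕ m0}
    {γ : ℝ} (hγ0 : 0 ≤ γ) (hγ1 : γ < 1) {r q₀ : S → A → ℝ}
    {P : S → A → S → ℝ} (hP0 : ∀ s a s', 0 ≤ P s a s') (hP1 : ∀ s a, ∑ s', P s a s' = 1)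
    {st : ℕ → Ω → S} {ac : ℕ → Ω → A} {α : ℕ → Ω → ℝ}
    (hst : ∀ k, Measurable[ℱ k] (st k)) (hac : ∀ k, Measurable[ℱ k] (ac k))
    (hαm : ∀ k, Measurable[ℱ k] (α k)) (hα : ∀ k ω, α k ω ∈ Set.Ioc (0 : ℝ) 1)
    (hcond : ∀ k (f : S → ℝ), μ[fun ω => f (st (k + 1) ω)|ℱ k]
      =ᵐ[μ] fun ω => ∑ s', P (st k ω) (ac k ω) s' * f s')
    {q : ℕ → Ω → S → A → ℝ} (hq0 : ∀ ω, q 0 ω = q₀)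
    (hq : ∀ k ω s a, q (k + 1) ω s a = if s = st k ω ∧ a = ac k ω then
      (1 - α k ω) * q k ω s a + α k ω * (r s a + γ * ⨆ a', q k ω (st (k + 1) ω) a')
      else q k ω s a)
    (hRM : ∀ᵐ ω ∂μ, ∀ s a,
      (¬ Summable fun k => if st k ω = s ∧ ac k ω = a then α k ω else 0) ∧
      (Summable fun k => if st k ω = s ∧ ac k ω = a then (α k ω) ^ 2 else 0))
    {Q : S → A → ℝ} (hQ : ∀ s a, Q s a = r s a + γ * ∑ s', P s a s' * ⨆ a', Q s' a') :
    ∀ᵐ ω ∂μ, ∀ s a, Tendsto (fun k => q k ω s a) atTop (nhds (Q s a)) := by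
  obtain ⟨B, hB⟩ := exists_abs_qIterate_le hγ0 hγ1 hα hq0 hq
  have hqm := measurable_qIterate hst hac hαm hq0 hq
  let β : ℕ → Ω → S × A → ℝ := fun k ω x => if st k ω = x.1 ∧ ac k ω = x.2 then α k ω else 0
  have hβ0 : ∀ k ω x, 0 ≤ β k ω x := fun k ω x => by
    have := (hα k ω).1.le
    simp only [β]; split_ifs <;> simp [this]
  have hβ1 : ∀ k ω x, β k ω x ≤ 1 := fun k ω x => by
    have := (hα k ω).2
    simp only [β]; split_ifs <;> simp [this]
  have hβm : ∀ k x, Measurable[ℱ k] fun ω => β k ω x := fun k x =>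
    Measurable.ite ((hst k (measurableSet_singleton x.1)).inter
      (hac k (measurableSet_singleton x.2))) (hαm k) measurable_const
  let g : ℕ → Ω → S → ℝ := fun k ω s => ⨆ a', q k ω s a'
  have hg : ∀ k ω s, |g k ω s| ≤ B := fun k ω s => abs_ciSup_le (hB k ω s)
  have hnoise : ∀ᵐ ω ∂μ, ∀ (x : S × A) (s' : S), ∃ c,
      Tendsto (fun n => ∑ k ∈ Finset.range n, β k ω x * g k ω s' *
        ((if st (k + 1) ω = s' then 1 else 0) - P (st k ω) (ac k ω) s')) atTop (nhds c) := by
    refine ae_all_iff.2 fun x => ae_all_iff.2 fun s' =>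
      ae_exists_tendsto_nextState_noise hP0 hP1 hst hac hcond (C := B)
        (b := fun k ω => β k ω x * g k ω s')
        (fun k => (hβm k x).mul (Measurable.iSup fun a' => hqm k s' a')) (fun k ω => ?_) ?_ s'
    · rw [abs_mul, abs_of_nonneg (hβ0 k ω x)]
      exact (mul_le_of_le_one_left (abs_nonneg _) (hβ1 k ω x)).trans (hg k ω s')
    · filter_upwards [hRM] with ω hω
      refine Summable.of_nonneg_of_le (fun k => sq_nonneg _) (fun k => ?_)
        ((hω x.1 x.2).2.mul_right (B ^ 2))
      rw [mul_pow]
      have h1 : g k ω s' ^ 2 ≤ B ^ 2 := sq_le_sq.2 ((hg k ω s').trans (le_abs_self B))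
      have h2 : β k ω x ^ 2 = if st k ω = x.1 ∧ ac k ω = x.2 then α k ω ^ 2 else 0 := by
        simp only [β]; split_ifs <;> simp
      rw [← h2]
      exact mul_le_mul_of_nonneg_left h1 (sq_nonneg _)
  filter_upwards [hnoise, hRM] with ω hω hωRM
  have key := tendsto_zero_of_contraction_noise (I := S × A)
    (e := fun k x => q k ω x.1 x.2 - Q x.1 x.2) (β := fun k x => β k ω x)
    (F := fun k x => γ * ∑ s', P x.1 x.2 s' * (g k ω s' - ⨆ a', Q s' a'))
    (w := fun k x => γ * (g k ω (st (k + 1) ω) - ∑ s', P x.1 x.2 s' * g k ω s'))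
    (B := B + ∑ x : S × A, |Q x.1 x.2|) hγ0 hγ1 (fun k => hβ0 k ω) (fun k => hβ1 k ω)
    (fun x => (hωRM x.1 x.2).1) ?_ ?_ ?_ ?_
  · intro s a
    simpa using (key (s, a)).add_const (Q s a)
  · rintro k ⟨s, a⟩
    dsimp only
    simp only [mul_sub, Finset.sum_sub_distrib]
    have h1 := hQ s a
    rw [hq]
    by_cases h : st k ω = s ∧ ac k ω = a
    · rw [if_pos ⟨h.1.symm, h.2.symm⟩]
      have h2 : β k ω (s, a) = α k ω := if_pos h
      rw [h2]
      simp only [g]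
      linear_combination (-(α k ω)) * h1
    · rw [if_neg fun h' => h ⟨h'.1.symm, h'.2.symm⟩]
      have h2 : β k ω (s, a) = 0 := if_neg h
      rw [h2]
      ring
  · intro k D hD x
    rw [abs_mul, abs_of_nonneg hγ0]
    exact mul_le_mul_of_nonneg_left (abs_sum_mul_le_of_stochastic (hP0 _ _) (hP1 _ _)
      fun s' => abs_ciSup_sub_ciSup_le fun a' => hD (s', a')) hγ0
  · intro x
    choose c hc using hω x
    refine ⟨γ * ∑ s', c s', ?_⟩
    refine ((tendsto_finsetSum Finset.univ fun s' _ => hc s').const_mul γ).congr fun n => ?_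
    rw [Finset.sum_comm, Finset.mul_sum]
    refine Finset.sum_congr rfl fun k _ => ?_
    by_cases h : st k ω = x.1 ∧ ac k ω = x.2
    · rw [h.1, h.2]
      simp only [mul_sub, mul_ite, mul_one, mul_zero, Finset.sum_sub_distrib, Finset.sum_ite_eq,
        Finset.mem_univ, if_true, Finset.mul_sum]
      congr 1
      · ring
      · exact Finset.sum_congr rfl fun s' _ => by ring
    · have h2 : β k ω x = 0 := if_neg h
      simp [h2]
  · rintro k ⟨s, a⟩
    have h1 := Finset.single_le_sum (f := fun x : S × A => |Q x.1 x.2|)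
      (fun _ _ => abs_nonneg _) (Finset.mem_univ (s, a))
    exact (abs_sub _ _).trans (add_le_add (hB k ω s a) h1)

/-- Convergence of tabular ξ-learning: under infinite visits and Robbins–Monro learning
rates, the induced Q-iterates `Q_k(s,a) = Σ_φ R(φ) ξ_k(s,a,φ)` converge almost surely,
for every `(s,a)`, to the unique fixed point `Q*` of the Bellman optimality operator. -/
theorem xi_learning_convergence
    {S A Φ : Type*} [Fintype S] [Fintype A] [Fintype Φ]
    [Nonempty S] [Nonempty A] [Nonempty Φ]
    [MeasurableSpace S] [MeasurableSingletonClass S]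
    [MeasurableSpace A] [MeasurableSingletonClass A]
    (γ : ℝ) (hγ0 : 0 ≤ γ) (hγ1 : γ < 1)
    (R : Φ → ℝ)
    (P : S → A → S → ℝ) (hP0 : ∀ s a s', 0 ≤ P s a s')
    (hP1 : ∀ s a, ∑ s', P s a s' = 1)
    (p : S → A → Φ → ℝ) (hp0 : ∀ s a φ, 0 ≤ p s a φ)
    (hp1 : ∀ s a, ∑ φ, p s a φ = 1)
    {Ω : Type*} [m0 : MeasurableSpace Ω] (Pr : Measure Ω) [IsProbabilityMeasure Pr]
    (𝔉 : Filtration ℕ m0)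
    (st : ℕ → Ω → S) (ac : ℕ → Ω → A) (α : ℕ → Ω → ℝ)
    (hst_adapted : ∀ k, Measurable[𝔉 k] (st k))
    (hac_adapted : ∀ k, Measurable[𝔉 k] (ac k))
    (hα_adapted : ∀ k, Measurable[𝔉 k] (α k))
    (hst_next : ∀ k, Measurable[𝔉 (k + 1)] (st (k + 1)))
    (hα_mem : ∀ k ω, α k ω ∈ Set.Ioc (0 : ℝ) 1)
    -- conditionally on the past, `s_{k+1}` is distributed according to `P(·|s_k, a_k)`
    (hcond : ∀ k (f : S → ℝ),
      (Pr[(fun ω => f (st (k + 1) ω))|𝔉 k])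
        =ᵐ[Pr] fun ω => ∑ s', P (st k ω) (ac k ω) s' * f s')
    (ξ : ℕ → Ω → S → A → Φ → ℝ) (ξ₀ : S → A → Φ → ℝ)
    (abar : ℕ → Ω → A)
    -- `ā_{k+1}` is a greedy action in `s_{k+1}` for the Q-function induced by `ξ_k`
    (habar : ∀ k ω a', (∑ φ, R φ * ξ k ω (st (k + 1) ω) a' φ) ≤
      ∑ φ, R φ * ξ k ω (st (k + 1) ω) (abar k ω) φ)
    (hξ0 : ∀ ω, ξ 0 ω = ξ₀)
    (hξrec : ∀ k ω s a φ,
      ξ (k + 1) ω s a φ =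
        if s = st k ω ∧ a = ac k ω then
          (1 - α k ω) * ξ k ω s a φ +
            α k ω * (p s a φ + γ * ξ k ω (st (k + 1) ω) (abar k ω) φ)
        else ξ k ω s a φ)
    -- almost surely every pair `(s,a)` is visited infinitely often
    (hvisit : ∀ᵐ ω ∂Pr, ∀ s a, {k | st k ω = s ∧ ac k ω = a}.Infinite)
    -- Robbins–Monro conditions at the visits to each `(s,a)`
    (hRM : ∀ᵐ ω ∂Pr, ∀ s a,
      (¬ Summable fun k => if st k ω = s ∧ ac k ω = a then α k ω else 0) ∧
      (Summable fun k => if st k ω = s ∧ ac k ω = a then (α k ω) ^ 2 else 0))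
    (T : (S → A → ℝ) → (S → A → ℝ))
    (hT : ∀ Q s a, T Q s a =
      (∑ φ, p s a φ * R φ) + γ * ∑ s', P s a s' * ⨆ a', Q s' a')
    (Qstar : S → A → ℝ) (hQstar : T Qstar = Qstar)
    (hQuniq : ∀ Q, T Q = Q → Q = Qstar) :
    ∀ᵐ ω ∂Pr, ∀ s a,
      Tendsto (fun k => ∑ φ, R φ * ξ k ω s a φ) atTop (nhds (Qstar s a)) := by
  have hqrec : ∀ k ω s a, (∑ φ, R φ * ξ (k + 1) ω s a φ) = if s = st k ω ∧ a = ac k ω then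
      (1 - α k ω) * (∑ φ, R φ * ξ k ω s a φ) + α k ω * ((∑ φ, p s a φ * R φ) +
        γ * ⨆ a', ∑ φ, R φ * ξ k ω (st (k + 1) ω) a' φ)
      else ∑ φ, R φ * ξ k ω s a φ := by
    intro k ω s a
    have hsup : (⨆ a', ∑ φ, R φ * ξ k ω (st (k + 1) ω) a' φ) =
        ∑ φ, R φ * ξ k ω (st (k + 1) ω) (abar k ω) φ :=
      le_antisymm (ciSup_le fun a' => habar k ω a')
        (le_ciSup (f := fun a' => ∑ φ, R φ * ξ k ω (st (k + 1) ω) a' φ)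
          (Set.finite_range _).bddAbove (abar k ω))
    simp only [hξrec, hsup]
    split_ifs
    · simp only [Finset.mul_sum, ← Finset.sum_add_distrib]
      exact Finset.sum_congr rfl fun φ _ => by ring
    · rfl
  exact ae_tendsto_qIterate (q := fun k ω s a => ∑ φ, R φ * ξ k ω s a φ)
    (q₀ := fun s a => ∑ φ, R φ * ξ₀ s a φ) (r := fun s a => ∑ φ, p s a φ * R φ)
    hγ0 hγ1 hP0 hP1 hst_adapted hac_adapted hα_adapted hα_mem hcond
    (fun ω => by simp only [hξ0]) hqrec hRM
    (fun s a => by rw [← hT Qstar s a, hQstar])
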